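/- Let A be the monomial algebra on 13 generators defined below and K the trivial A-module. Then there exist a class e ∈ Extᴬ¹(K,K) and a class α ∈ Extᴬ²(K,K) whose Yoneda product eα ∈ Extᴬ³(K,K) is nonzero. -/

import Mathlib

/-!
Let `K` be a field and `V` a 13-dimensional `K`-vector space with basis
`{m,n,p,q,r,s,t,u,v,w,x,y,z}`.  Let `A = T(V)/I` be the quotient of the free
(tensor) algebra on `V` by the two-sided ideal generated by the nine monomials
`mn²p, n²pqr, npqrs, pqrst, stu, tuvwx, uvwxy, vwxy², xy²z`, and regard `K` as
the trivial left `A`-module via the augmentation sending every generator to `0`.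
-/

open CategoryTheory

/-- The thirteen generators `m,n,p,q,r,s,t,u,v,w,x,y,z` of the algebra `A`. -/
inductive Gen : Type
  | m | n | p | q | r | s | t | u | v | w | x | y | z

variable (K : Type) [Field K]

open Gen

/-- The generator `i`, as an element of the tensor algebra `T(V)`. -/
noncomputable def g (i : Gen) : FreeAlgebra K Gen := FreeAlgebra.ι K i

/-- The relation identifying each of the nine defining monomials with `0`;
the quotient of `T(V)` by this relation is exactly `T(V)/I` where `I` is the
two-sided ideal generated by the nine monomials. -/
inductive MonRel : FreeAlgebra K Gen → FreeAlgebra K Gen → Prop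
  | mnnp : MonRel (g K m * g K n * g K n * g K p) 0
  | nnpqr : MonRel (g K n * g K n * g K p * g K q * g K r) 0
  | npqrs : MonRel (g K n * g K p * g K q * g K r * g K s) 0
  | pqrst : MonRel (g K p * g K q * g K r * g K s * g K t) 0
  | stu : MonRel (g K s * g K t * g K u) 0
  | tuvwx : MonRel (g K t * g K u * g K v * g K w * g K x) 0
  | uvwxy : MonRel (g K u * g K v * g K w * g K x * g K y) 0
  | vwxyy : MonRel (g K v * g K w * g K x * g K y * g K y) 0
  | xyyz : MonRel (g K x * g K y * g K y * g K z) 0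

/-- The monomial algebra `A = T(V)/I`. -/
noncomputable abbrev A : Type := RingQuot (MonRel K)

/-- The augmentation `A →ₐ[K] K`, sending every generator to `0`. -/
noncomputable def aug : A K →ₐ[K] K :=
  RingQuot.liftAlgHom K ⟨FreeAlgebra.lift K (fun _ => (0 : K)), by
    rintro x y h
    induction h <;> simp [g]⟩

/-- `K`, regarded as the trivial left `A`-module via the augmentation. -/
noncomputable def KMod : ModuleCat.{0} (A K) :=
  letI : Module (A K) K := Module.compHom K (aug K).toRingHom
  ModuleCat.of (A K) K

noncomputable local instance instDC : HasDerivedCategory.{1} (ModuleCat.{0} (A K)) :=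
  HasDerivedCategory.standard _

local instance instHE : HasExt.{1} (ModuleCat.{0} (A K)) :=
  @hasExt_of_hasDerivedCategory.{1, 0, 1} (ModuleCat.{0} (A K)) _ _ (instDC K)

/-- The Ext group `Extᴬⁿ(K, K)`; the Yoneda product of `a : E K i` and
`b : E K j` is given by the composition `a.comp b : E K (i + j)`. -/
noncomputable abbrev E (n : ℕ) : Type 1 := Abelian.Ext (KMod K) (KMod K) n

section DimensionShifting

variable {C : Type*} [Category* C] [Abelian C] [HasExt C]

/-- Dimension shifting along a morphism of short exact sequences `T ⟶ S` whose source has a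
projective middle term. Only the last two components of the morphism are given. -/
lemma exists_lift_of_comp_extClass_comp_eq_zero {S T : ShortComplex C} (hS : S.ShortExact)
    (hT : T.ShortExact) [Projective T.X₂] (φ₂ : T.X₂ ⟶ S.X₂) (φ₃ : T.X₃ ⟶ S.X₃)
    (comm : φ₂ ≫ S.g = T.g ≫ φ₃) :
    ∃ φ₁ : T.X₁ ⟶ S.X₁, φ₁ ≫ S.f = T.f ≫ φ₂ ∧
      ∀ {Z : C} {k l : ℕ} (h : 1 + (k + 1) = l) (x : Abelian.Ext S.X₁ Z (k + 1)),
        (Abelian.Ext.mk₀ φ₃).comp (hS.extClass.comp x h) (zero_add l) = 0 →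
          (Abelian.Ext.mk₀ φ₁).comp x (zero_add _) = 0 := by
  have := hS.mono_f
  have w : (T.f ≫ φ₂) ≫ S.g = 0 := by
    rw [Category.assoc, comm, T.zero_assoc, Limits.zero_comp]
  have hφ : hS.exact.lift (T.f ≫ φ₂) w ≫ S.f = T.f ≫ φ₂ := hS.exact.lift_f _ _
  refine ⟨hS.exact.lift (T.f ≫ φ₂) w, hφ, fun {Z k l} h x hx => ?_⟩
  let φ : T ⟶ S := ⟨hS.exact.lift (T.f ≫ φ₂) w, φ₂, φ₃, hφ, comm⟩
  have nat := ShortComplex.ShortExact.extClass_naturality hT hS φ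
  have hδ : hT.extClass.comp ((Abelian.Ext.mk₀ φ.τ₁).comp x (zero_add _)) h = 0 := by
    rw [← Abelian.Ext.comp_assoc_of_second_deg_zero, nat,
      Abelian.Ext.comp_assoc _ _ _ (zero_add 1) h (by lia)]
    exact hx
  obtain ⟨y, hy⟩ := Abelian.Ext.contravariant_sequence_exact₁ hT Z _ h hδ
  rw [Abelian.Ext.eq_zero_of_projective y, Abelian.Ext.comp_zero] at hy
  exact hy.symm

end DimensionShifting

/-- Dimension shifting for the presentation of the cyclic submodule generated by `e` by the free
module of rank one, mapped to a short exact sequence `S` by sending `1` to `y`. -/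
lemma ModuleCat.exists_lift_of_comp_extClass_comp_eq_zero {R : Type} [Ring R]
    [HasExt (ModuleCat.{0} R)] {S : ShortComplex (ModuleCat.{0} R)} (hS : S.ShortExact)
    {M : ModuleCat.{0} R} (e : M) (y : S.X₂) (φ : M ⟶ S.X₃) (hφ : φ e = S.g y) :
    ∃ ψ : ModuleCat.of R (LinearMap.ker (LinearMap.toSpanSingleton R M e)) ⟶ S.X₁,
      (∀ a, S.f (ψ a) = a.1 • y) ∧
      ∀ {Z : ModuleCat.{0} R} {k l : ℕ} (h : 1 + (k + 1) = l) (x : Abelian.Ext S.X₁ Z (k + 1)),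
        (Abelian.Ext.mk₀ φ).comp (hS.extClass.comp x h) (zero_add l) = 0 →
          (Abelian.Ext.mk₀ ψ).comp x (zero_add _) = 0 := by
  let f := LinearMap.toSpanSingleton R M e
  have : Projective f.rangeRestrict.shortComplexKer.X₂ :=
    inferInstanceAs (Projective (ModuleCat.of R R))
  obtain ⟨ψ, hψ, H⟩ := _root_.exists_lift_of_comp_extClass_comp_eq_zero hS
    (LinearMap.shortExact_shortComplexKer f.surjective_rangeRestrict)
    (ModuleCat.ofHom (LinearMap.toSpanSingleton R S.X₂ y))
    (ModuleCat.ofHom (LinearMap.range f).subtype ≫ φ) (by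
      ext
      simp [f, hφ])
  have hker : LinearMap.ker f ≤ LinearMap.ker f.rangeRestrict := f.ker_rangeRestrict.ge
  refine ⟨ModuleCat.ofHom (Submodule.inclusion hker) ≫ ψ,
    fun a => ConcreteCategory.congr_hom hψ (Submodule.inclusion hker a), fun h x hx => ?_⟩
  rw [← Abelian.Ext.mk₀_comp_mk₀_assoc, H h x, Abelian.Ext.comp_zero]
  rw [← Abelian.Ext.mk₀_comp_mk₀_assoc, hx, Abelian.Ext.comp_zero]

/-- The class in `A` of the generator `i`. -/
noncomputable def gen (i : Gen) : A K := RingQuot.mkAlgHom K (MonRel K) (g K i)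

@[simp]
lemma aug_gen (i : Gen) : aug K (gen K i) = 0 := by
  rw [aug, gen, RingQuot.liftAlgHom_mkAlgHom_apply]
  simp [g]

variable {K} in
lemma AlgHom.apply_comm_of_gen {X Y : Type*} [AddCommGroup X] [Module K X] [AddCommGroup Y]
    [Module K Y] (ρ : A K →ₐ[K] Module.End K X) (σ : A K →ₐ[K] Module.End K Y) (φ : X →ₗ[K] Y)
    (h : ∀ i x, φ (ρ (gen K i) x) = σ (gen K i) (φ x)) (a : A K) (x : X) :
    φ (ρ a x) = σ a (φ x) := by
  obtain ⟨b, rfl⟩ := RingQuot.mkAlgHom_surjective K (MonRel K) a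
  induction b using FreeAlgebra.induction generalizing x with
  | grade0 c => simp
  | grade1 i => exact h i x
  | mul a b ha hb => simp [ha, hb]
  | add a b ha hb => simp [ha, hb]

section StringModule

variable {k : ℕ}

noncomputable instance : DecidableEq Gen := Classical.decEq Gen

/-- The operator sending the `j`-th basis vector to the next one if the `j`-th letter of `w`
is `i`, and to zero otherwise. -/
noncomputable def shift (w : Fin k → Gen) (i : Gen) : Module.End K (Fin (k + 1) → K) where
  toFun f := Fin.cons 0 fun j => if w j = i then f j.castSucc else 0
  map_add' f f' := by
    ext j
    cases j using Fin.cases <;> simp [ite_add_zero]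
  map_smul' c f := by
    ext j
    cases j using Fin.cases <;> simp

/-- The operators `shift K w i` satisfy the defining relations of `A`. -/
def Admissible (w : Fin k → Gen) : Prop :=
  ∀ ⦃a b : FreeAlgebra K Gen⦄, MonRel K a b →
    FreeAlgebra.lift K (shift K w) a = FreeAlgebra.lift K (shift K w) b

variable {K}

/-- The representation of `A` given by the operators `shift K w i`. -/
noncomputable def Admissible.rep {w : Fin k → Gen} (h : Admissible K w) :
    A K →ₐ[K] Module.End K (Fin (k + 1) → K) :=
  RingQuot.liftAlgHom K ⟨FreeAlgebra.lift K (shift K w), fun _ _ hab => h hab⟩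

@[simp]
lemma Admissible.rep_gen {w : Fin k → Gen} (h : Admissible K w) (i : Gen) :
    h.rep (gen K i) = shift K w i := by
  rw [Admissible.rep, gen, RingQuot.liftAlgHom_mkAlgHom_apply]
  simp [g]

/-- The uniserial `A`-module attached to the word `w`. -/
def StringModule {w : Fin k → Gen} (_ : Admissible K w) : Type := Fin (k + 1) → K

instance {w : Fin k → Gen} (h : Admissible K w) : AddCommGroup (StringModule h) :=
  inferInstanceAs (AddCommGroup (Fin (k + 1) → K))

noncomputable instance {w : Fin k → Gen} (h : Admissible K w) : Module (A K) (StringModule h) :=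
  Module.compHom (Fin (k + 1) → K) h.rep.toRingHom

/-- The string module as an object of the category of `A`-modules. -/
noncomputable abbrev Admissible.obj {w : Fin k → Gen} (h : Admissible K w) :
    ModuleCat.{0} (A K) :=
  ModuleCat.of (A K) (StringModule h)

/-- The surjection of a string module onto its top. -/
noncomputable def Admissible.toTop {w : Fin k → Gen} (h : Admissible K w) :
    StringModule h →ₗ[A K] KMod K where
  toFun f := (f 0 : K)
  map_add' _ _ := rfl
  map_smul' a f := by
    refine AlgHom.apply_comm_of_gen h.rep ((Algebra.lmul K K).comp (aug K))
      (LinearMap.proj 0) (fun i x => ?_) a f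
    simp [shift]

/-- The inclusion of the radical of a string module. -/
noncomputable def Admissible.fromTail {w : Fin (k + 1) → Gen} {w' : Fin k → Gen}
    (h : Admissible K w) (h' : Admissible K w') (hw : ∀ j, w j.succ = w' j) :
    StringModule h' →ₗ[A K] StringModule h where
  toFun f := Fin.cons (α := fun _ => K) 0 f
  map_add' f f' := by
    refine funext fun j : Fin (k + 2) => ?_
    cases j using Fin.cases
    · exact (add_zero 0).symm
    · rfl
  map_smul' a f := by
    let φ : (Fin (k + 1) → K) →ₗ[K] (Fin (k + 2) → K) :=
      { toFun f := Fin.cons 0 f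
        map_add' f f' := by
          ext j
          cases j using Fin.cases <;> simp
        map_smul' c f := by
          ext j
          cases j using Fin.cases <;> simp }
    refine AlgHom.apply_comm_of_gen h'.rep h.rep φ (fun i x => ?_) a f
    ext j
    cases j using Fin.cases with
    | zero => simp [φ, shift]
    | succ j =>
      cases j using Fin.cases with
      | zero => simp [φ, shift]
      | succ j => simp [φ, shift, hw j]

/-- The quotient of a string module by its socle. -/
noncomputable def Admissible.toInit {w : Fin (k + 1) → Gen} {w' : Fin k → Gen}
    (h : Admissible K w) (h' : Admissible K w') (hw : ∀ j, w j.castSucc = w' j) :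
    StringModule h →ₗ[A K] StringModule h' where
  toFun f j := f j.castSucc
  map_add' _ _ := rfl
  map_smul' a f := by
    refine AlgHom.apply_comm_of_gen h.rep h'.rep (LinearMap.funLeft K K Fin.castSucc)
      (fun i x => ?_) a f
    ext j
    cases j using Fin.cases with
    | zero => simp [shift, LinearMap.funLeft]
    | succ j => simp [shift, LinearMap.funLeft, hw j]

/-- The inclusion of the socle of a string module. -/
noncomputable def Admissible.fromSocle {w : Fin k → Gen} (h : Admissible K w) :
    KMod K →ₗ[A K] StringModule h where
  toFun c := Pi.single (M := fun _ => K) (Fin.last k) c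
  map_add' c d := Pi.single_add (f := fun _ => K) _ c d
  map_smul' a c := by
    refine AlgHom.apply_comm_of_gen ((Algebra.lmul K K).comp (aug K)) h.rep
      (LinearMap.single K (fun _ => K) (Fin.last k)) (fun i x => ?_) a c
    ext j
    cases j using Fin.cases with
    | zero => simp [shift]
    | succ j => simp [shift, Pi.single_apply, (Fin.castSucc_lt_last _).ne]

lemma Admissible.shortExact_fromTail_toTop {w : Fin (k + 1) → Gen} {w' : Fin k → Gen}
    (h : Admissible K w) (h' : Admissible K w') (hw : ∀ j, w j.succ = w' j) :
    ∃ zero, (ShortComplex.mk (X₁ := h'.obj) (X₂ := h.obj) (X₃ := KMod K)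
      (ModuleCat.ofHom (h.fromTail h' hw)) (ModuleCat.ofHom (Y := KMod K) h.toTop) zero).ShortExact := by
  refine ⟨rfl, ModuleCat.shortComplex_shortExact _ (fun f => ?_)
    (Fin.cons_right_injective (α := fun _ => K) (0 : K)) (fun c => ?_)⟩
  · constructor
    · intro hf
      refine ⟨Fin.tail (α := fun _ => K) f, ?_⟩
      exact (congrArg (fun c : K => Fin.cons (α := fun _ => K) c _) hf.symm).trans
        (Fin.cons_self_tail (α := fun _ => K) f)
    · rintro ⟨f, rfl⟩
      rfl
  · exact ⟨fun _ => (c : K), rfl⟩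

lemma Admissible.shortExact_fromSocle_toInit {w : Fin (k + 1) → Gen} {w' : Fin k → Gen}
    (h : Admissible K w) (h' : Admissible K w') (hw : ∀ j, w j.castSucc = w' j) :
    ∃ zero, (ShortComplex.mk (X₁ := KMod K) (X₂ := h.obj) (X₃ := h'.obj)
      (ModuleCat.ofHom (X := KMod K) h.fromSocle)
      (ModuleCat.ofHom (h.toInit h' hw)) zero).ShortExact := by
  have zero (c : K) (j : Fin (k + 1)) :
      Pi.single (M := fun _ => K) (Fin.last (k + 1)) c j.castSucc = 0 := by
    simp [(Fin.castSucc_lt_last j).ne]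
  refine ⟨ModuleCat.hom_ext (LinearMap.ext fun c => funext (zero c)),
    ModuleCat.shortComplex_shortExact _ (fun f => ?_)
    (Pi.single_injective (M := fun _ => K) (Fin.last (k + 1))) (fun f => ?_)⟩
  · constructor
    · intro hf
      refine ⟨(f (Fin.last (k + 1)) : K), funext fun j : Fin (k + 2) => ?_⟩
      cases j using Fin.lastCases with
      | last => exact Pi.single_eq_same (M := fun _ => K) _ _
      | cast j => exact (zero _ j).trans (congrFun hf j).symm
    · rintro ⟨c, rfl⟩
      exact funext (zero c)
  · exact ⟨Fin.snoc (α := fun _ => K) f 0, funext fun j => Fin.snoc_castSucc (α := fun _ => K) _ _ j⟩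

end StringModule

lemma shift_one (a i : Gen) (f : Fin 2 → K) :
    shift K ![a] i f = ![0, if a = i then f 0 else 0] := by
  ext j
  fin_cases j <;> rfl

lemma shift_three (a b c i : Gen) (f : Fin 4 → K) :
    shift K ![a, b, c] i f =
      ![0, if a = i then f 0 else 0, if b = i then f 1 else 0, if c = i then f 2 else 0] := by
  ext j
  fin_cases j <;> rfl

lemma shift_four (a b c d i : Gen) (f : Fin 5 → K) :
    shift K ![a, b, c, d] i f =
      ![0, if a = i then f 0 else 0, if b = i then f 1 else 0, if c = i then f 2 else 0,
        if d = i then f 3 else 0] := by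
  ext j
  fin_cases j <;> rfl

lemma admissible_empty : Admissible K ![] := by
  have (i : Gen) : shift K ![] i = 0 := by
    refine LinearMap.ext fun f => funext fun j => ?_
    fin_cases j
    rfl
  rintro a b ⟨⟩ <;> simp [g, this]

lemma admissible_s : Admissible K ![s] := by
  rintro a b ⟨⟩ <;> refine LinearMap.ext fun f => ?_ <;> simp [g, shift_one]

lemma admissible_qpn : Admissible K ![q, p, n] := by
  rintro a b ⟨⟩ <;> refine LinearMap.ext fun f => ?_ <;> simp [g, shift_three]

lemma admissible_qpnn : Admissible K ![q, p, n, n] := by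
  rintro a b ⟨⟩ <;> refine LinearMap.ext fun f => ?_ <;> simp [g, shift_four]

lemma admissible_rqpn : Admissible K ![r, q, p, n] := by
  rintro a b ⟨⟩ <;> refine LinearMap.ext fun f => ?_ <;> simp [g, shift_four]

/-- There exist `e ∈ Extᴬ¹(K,K)` and `α ∈ Extᴬ²(K,K)` whose
Yoneda product `eα ∈ Extᴬ³(K,K)` is nonzero. -/
theorem statement_11 :
    ∃ (e : E K 1) (α : E K 2), e.comp α (by norm_num : 1 + 2 = 3) ≠ 0 := by
  obtain ⟨_, hS₁⟩ := (admissible_s K).shortExact_fromTail_toTop (admissible_empty K) nofun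
  obtain ⟨_, hS₂⟩ := (admissible_rqpn K).shortExact_fromTail_toTop (admissible_qpn K) fun _ => rfl
  obtain ⟨_, hS₃⟩ := (admissible_qpnn K).shortExact_fromSocle_toInit (admissible_qpn K) fun j => by
    fin_cases j <;> rfl
  let κ : (admissible_empty K).obj ⟶ KMod K := ModuleCat.ofHom (Y := KMod K) (admissible_empty K).toTop
  refine ⟨hS₁.extClass.comp (Abelian.Ext.mk₀ κ) (add_zero 1),
    hS₂.extClass.comp hS₃.extClass rfl, fun H => ?_⟩
  let top : KMod K := (1 : K)
  obtain ⟨ψ, hψ, H₁⟩ := ModuleCat.exists_lift_of_comp_extClass_comp_eq_zero hS₁ top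
    (![1, 0] : Fin 2 → K) (𝟙 _) rfl
  replace H₁ := H₁ (l := 3) rfl
    ((Abelian.Ext.mk₀ κ).comp (hS₂.extClass.comp hS₃.extClass rfl) (zero_add 2)) (by
      rw [Abelian.Ext.mk₀_id_comp, ← Abelian.Ext.comp_assoc_of_second_deg_zero]
      exact H)
  let sΩ : LinearMap.ker (LinearMap.toSpanSingleton (A K) (KMod K) top) :=
    ⟨gen K s, by
      change aug K (gen K s) * (1 : K) = 0
      simp⟩
  have hκ : κ (ψ sΩ) = (1 : K) := by
    refine (congrFun (hψ sΩ) (1 : Fin 2)).trans ?_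
    change (admissible_s K).rep (gen K s) ![1, 0] 1 = 1
    simp [shift_one]
  obtain ⟨τ, hτ, H₂⟩ := ModuleCat.exists_lift_of_comp_extClass_comp_eq_zero hS₂ sΩ
    (![1, 0, 0, 0, 0] : Fin 5 → K) (ψ ≫ κ) hκ
  replace H₂ := H₂ rfl hS₃.extClass (by
    rw [← Abelian.Ext.mk₀_comp_mk₀_assoc, H₁])
  obtain ⟨x, hx⟩ := Abelian.Ext.covariant_sequence_exact₃ _ hS₃ (Abelian.Ext.mk₀ τ) rfl H₂
  obtain ⟨lam, rfl⟩ := (Abelian.Ext.mk₀_bijective _ _).2 x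
  rw [Abelian.Ext.mk₀_comp_mk₀] at hx
  replace hx := (Abelian.Ext.mk₀_bijective _ _).1 hx
  have hnpqrs : gen K n * gen K p * gen K q * gen K r * gen K s = 0 := by
    simpa [gen] using RingQuot.mkAlgHom_rel K (MonRel.npqrs (K := K))
  have hnnpqr : gen K n * (gen K n * gen K p * gen K q * gen K r) = 0 := by
    simpa [gen, mul_assoc] using RingQuot.mkAlgHom_rel K (MonRel.nnpqr (K := K))
  let b : LinearMap.ker (LinearMap.toSpanSingleton (A K) _ sΩ) :=
    ⟨gen K n * gen K p * gen K q * gen K r, Subtype.ext hnpqrs⟩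
  have hb : gen K n • b = 0 := Subtype.ext hnnpqr
  have hlam : (lam b : Fin 5 → K) 3 = 1 := by
    refine (congrFun (ConcreteCategory.congr_hom hx b) (3 : Fin 4)).trans ?_
    refine (congrFun (hτ b) (4 : Fin 5)).trans ?_
    change (admissible_rqpn K).rep (gen K n * gen K p * gen K q * gen K r) ![1, 0, 0, 0, 0] 4 = 1
    simp [shift_four]
  have hzero : (admissible_qpnn K).rep (gen K n) (lam b) = 0 := by
    change gen K n • lam b = 0
    rw [← map_smul, hb, map_zero]
  have hne (f : Fin 5 → K) (hf : f 3 = 1) : (admissible_qpnn K).rep (gen K n) f ≠ 0 := fun h => by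
    have := congrFun h 4
    simp [shift_four, hf] at this
  exact hne _ hlam hzero
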